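/- Let A be a synthetic affinographic arrangement of hyperplanes in an affine geometry (with projective completion P and ideal hyperplane h_∞), with associated graph Δ and constructed graph-with-bias Ω(A). Then: (1) Ω(A) is a biased graph; (2) the intersection semilattice L(A) := {t_A(S) : S an edge set, t_A(S) ≠ ∅}, ordered by reverse inclusion, is isomorphic to the semilattice of closed balanced edge sets of Ω(A) via h_e ↦ e; (3) L(A_P), the intersection lattice of the projectivized arrangement A_P := {projective completions of h ∈ A} ∪ {h_∞}, is isomorphic to the lattice of closed sets of the extended lift matroid L_0(Ω(A)) via the same correspondence together with h_∞ ↦ e_0; and (4) an edge set S has t_A(S) ≠ ∅ if and only if S is balanced in Ω(A). -/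

import Mathlib

open scoped Classical

/-! ## Graphs with parallel links and half edges -/

/-- A multigraph: each edge has a finite set of endpoints
(one endpoint for a half edge, two endpoints for a link). -/
structure MGraph (N : Type*) (E : Type*) where
  ends : E → Finset N

namespace MGraph

variable {N E : Type*} (G : MGraph N E)

/-- A link has two distinct endpoints. -/
def IsLink (e : E) : Prop := (G.ends e).card = 2

/-- A half edge has exactly one endpoint. -/
def IsHalfEdge (e : E) : Prop := (G.ends e).card = 1

/-- The set of nodes of a set of edges. -/
def nodeSet (S : Set E) : Set N := {v | ∃ e ∈ S, v ∈ G.ends e}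

/-- The nodes of a finite set of edges. -/
noncomputable def nodesOf (S : Finset E) : Finset N := S.biUnion G.ends

/-- The degree of a node in a finite edge set. -/
noncomputable def degreeIn (S : Finset E) (v : N) : ℕ :=
  (S.filter (fun e => v ∈ G.ends e)).card

/-- Two nodes joined by an edge of `S`. -/
def adjIn (S : Set E) (u v : N) : Prop := ∃ e ∈ S, u ∈ G.ends e ∧ v ∈ G.ends e

/-- Connectivity of nodes through edges of `S`. -/
def nodeConn (S : Set E) : N → N → Prop := Relation.ReflTransGen (G.adjIn S)

/-- The components of the spanning subgraph `(N, S)`, as sets of nodes. -/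
def components (S : Set E) : Set (Set N) := {W | ∃ v : N, W = {u | G.nodeConn S u v}}

/-- The number of components of the spanning subgraph `(N, S)`. -/
noncomputable def numComponents (S : Set E) : ℕ := Nat.card ↥(G.components S)

/-- The components of the non-spanning subgraph `(N(S), S)`. -/
def componentsOn (S : Set E) : Set (Set N) :=
  {W | ∃ v ∈ G.nodeSet S, W = {u | G.nodeConn S u v}}

/-- The edges of `S` whose endpoints all lie in a node set `W`. -/
def edgesIn (S : Set E) (W : Set N) : Set E := {e | e ∈ S ∧ ∀ v ∈ G.ends e, v ∈ W}

/-- An edge set is connected if any two of its edges are joined through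
consecutively intersecting edges of the set. -/
def ConnEdges (S : Set E) : Prop :=
  ∀ e ∈ S, ∀ f ∈ S, Relation.ReflTransGen
    (fun a b => a ∈ S ∧ b ∈ S ∧ ∃ v : N, v ∈ G.ends a ∧ v ∈ G.ends b) e f

/-- A circle: the edge set of a connected subgraph in which every node has degree 2. -/
def IsCircle (C : Finset E) : Prop :=
  C.Nonempty ∧ (∀ e ∈ C, G.IsLink e) ∧ G.ConnEdges ↑C ∧
    ∀ v ∈ G.nodesOf C, G.degreeIn C v = 2

/-- A (simple, open) path joining two distinct nodes `u` and `v`. -/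
def IsPath (Q : Finset E) (u v : N) : Prop :=
  Q.Nonempty ∧ u ≠ v ∧ (∀ e ∈ Q, G.IsLink e) ∧ G.ConnEdges ↑Q ∧
    u ∈ G.nodesOf Q ∧ v ∈ G.nodesOf Q ∧
    G.degreeIn Q u = 1 ∧ G.degreeIn Q v = 1 ∧
    ∀ w ∈ G.nodesOf Q, w ≠ u → w ≠ v → G.degreeIn Q w = 2

/-- A simple graph: all edges are links and no two edges have the same endpoints. -/
def IsSimple : Prop := (∀ e : E, G.IsLink e) ∧ Function.Injective G.ends

/-- The graph is connected. -/
def IsConnected : Prop := ∀ u v : N, G.nodeConn Set.univ u v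

/-- Inseparable graph: connected, and for every partition of the edge set into two
nonempty parts the two parts share at least two nodes. -/
def IsInseparable : Prop :=
  G.IsConnected ∧ ∀ A B : Set E, A.Nonempty → B.Nonempty → Disjoint A B →
    A ∪ B = Set.univ → ∃ u v : N, u ≠ v ∧ u ∈ G.nodeSet A ∧ u ∈ G.nodeSet B ∧
      v ∈ G.nodeSet A ∧ v ∈ G.nodeSet B

/-- A linear class of circles: every member is a circle and no theta subgraph (the
union of three pairwise internally disjoint paths with the same two endpoints)
contains exactly two members of the class. -/
def IsLinearClass (B : Set (Finset E)) : Prop :=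
  (∀ C ∈ B, G.IsCircle C) ∧
  ∀ u v : N, ∀ P₁ P₂ P₃ : Finset E,
    G.IsPath P₁ u v → G.IsPath P₂ u v → G.IsPath P₃ u v →
    Disjoint P₁ P₂ → Disjoint P₁ P₃ → Disjoint P₂ P₃ →
    (↑(G.nodesOf P₁) ∩ ↑(G.nodesOf P₂) : Set N) = {u, v} →
    (↑(G.nodesOf P₁) ∩ ↑(G.nodesOf P₃) : Set N) = {u, v} →
    (↑(G.nodesOf P₂) ∩ ↑(G.nodesOf P₃) : Set N) = {u, v} →
    P₁ ∪ P₂ ∈ B → P₁ ∪ P₃ ∈ B → P₂ ∪ P₃ ∈ B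

/-- A balanced edge set with respect to a class `B` of balanced circles:
no half edges, and every circle inside it belongs to `B`. -/
def IsBalancedSet (B : Set (Finset E)) (S : Set E) : Prop :=
  (∀ e ∈ S, G.IsLink e) ∧ ∀ C : Finset E, ↑C ⊆ S → G.IsCircle C → C ∈ B

/-- The number of balanced components of the spanning subgraph `(N, S)`. -/
noncomputable def numBalComponents (B : Set (Finset E)) (S : Set E) : ℕ :=
  Nat.card ↥{W : Set N | W ∈ G.components S ∧ G.IsBalancedSet B (G.edgesIn S W)}

/-- Frame matroid rank function: `rk S = #N - b(S)`. -/
noncomputable def frameRk [Fintype N] (B : Set (Finset E)) (S : Set E) : ℕ :=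
  Fintype.card N - G.numBalComponents B S

/-- Graphic (cycle) matroid rank function: `rk S = #N - c(S)`. -/
noncomputable def graphicRk [Fintype N] (S : Set E) : ℕ :=
  Fintype.card N - G.numComponents S

/-- Graphic matroid rank of a finite edge set, computed inside its own node set
(valid also for infinite graphs): `rk S = #N(S) - c(N(S), S)`. -/
noncomputable def graphicRkOn (S : Finset E) : ℕ :=
  (G.nodesOf S).card - Nat.card ↥(G.componentsOn ↑S)

/-- Extended lift matroid rank function on `E ⊕ Unit`, where `Sum.inr ()` is the
extra point `e₀`: `rk S = #N - c(S ∩ E)` if `S ⊆ E` is balanced, and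
`#N - c(S ∩ E) + 1` if `S` is unbalanced or contains `e₀`. -/
noncomputable def liftRk [Fintype N] (B : Set (Finset E)) (S : Set (E ⊕ Unit)) : ℕ :=
  if G.IsBalancedSet B {e | Sum.inl e ∈ S} ∧ Sum.inr () ∉ S then
    Fintype.card N - G.numComponents {e | Sum.inl e ∈ S}
  else Fintype.card N - G.numComponents {e | Sum.inl e ∈ S} + 1

/-- Closed sets of the frame matroid (via the rank function; the matroid is finitary). -/
def FrameClosed [Fintype N] (B : Set (Finset E)) (S : Set E) : Prop :=
  ∀ e : E, (∃ S₀ : Finset E, ↑S₀ ⊆ S ∧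
    G.frameRk B ↑(insert e S₀) = G.frameRk B ↑S₀) → e ∈ S

/-- Closed sets of the extended lift matroid. -/
def LiftClosed [Fintype N] (B : Set (Finset E)) (S : Set (E ⊕ Unit)) : Prop :=
  ∀ x : E ⊕ Unit, (∃ S₀ : Finset (E ⊕ Unit), ↑S₀ ⊆ S ∧
    G.liftRk B ↑(insert x S₀) = G.liftRk B ↑S₀) → x ∈ S

/-- The balance-closure of an edge set. -/
def bcl (B : Set (Finset E)) (S : Set E) : Set E :=
  S ∪ {e | ∃ C ∈ B, e ∈ C ∧ ↑C ⊆ S ∪ {e}}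

/-- The subgraph of all links, as a graph on the same nodes. -/
def linkGraph : MGraph N {e : E // G.IsLink e} := ⟨fun e => G.ends e.val⟩

/-- Restriction of a class of circles to the subgraph of links. -/
def linkBal (B : Set (Finset E)) : Set (Finset {e : E // G.IsLink e}) :=
  {C | C.image Subtype.val ∈ B}

/-- The subgraph on a subset of the edges (spanning all nodes). -/
def sub (D : Set E) : MGraph N ↥D := ⟨fun f => G.ends f.val⟩

end MGraph

/-- A graph together with a distinguished class of "balanced" circles.
(It is a biased graph when the class is a linear class.) -/
structure BiasedGraph (N E : Type*) extends MGraph N E where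
  Bal : Set (Finset E)

/-- The complete graph on a node set `N`. -/
def completeMGraph (N : Type*) : MGraph N {q : Finset N // q.card = 2} := ⟨Subtype.val⟩

/-- A gain graph with gain group `Γ`: each edge is given by a source, a target
(equal for a half edge) and a gain in the direction from source to target. -/
structure GainGraph (N E : Type*) (Γ : Type*) [Group Γ] extends MGraph N E where
  src : E → N
  tgt : E → N
  gain : E → Γ
  ends_eq : ∀ e : E, ends e = {src e, tgt e}

namespace GainGraph

variable {N E Γ : Type*} [Group Γ] (Φ : GainGraph N E Γ)

/-- The gain of an edge in the direction from `u` to `v`. -/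
noncomputable def ogain (e : E) (u v : N) : Γ :=
  if Φ.src e = u ∧ Φ.tgt e = v then Φ.gain e else (Φ.gain e)⁻¹

/-- A balanced circle of a gain graph: a circle whose gain function is given by a
potential on the nodes (equivalently, the product of its gains along a cyclic
orientation is the identity). -/
def BalancedCircle (C : Finset E) : Prop :=
  Φ.toMGraph.IsCircle C ∧
    ∃ θ : N → Γ, ∀ e ∈ C, Φ.gain e = (θ (Φ.src e))⁻¹ * θ (Φ.tgt e)

/-- The biased graph `⟨Φ⟩` of a gain graph. -/
def biasedGraph : BiasedGraph N E := { Φ.toMGraph with Bal := {C | Φ.BalancedCircle C} }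

end GainGraph

/-- A biased expansion of a graph `Δ` along a projection `p`: `p` is surjective,
preserves endpoints, and every circle of `Δ` with a chosen lift of all but one of
its edges has a unique completion to a balanced circle. -/
def IsBiasedExpansion {N E E' : Type*} (G : MGraph N E) (B : Set (Finset E))
    (Δ : MGraph N E') (p : E → E') : Prop :=
  Function.Surjective p ∧ (∀ e : E, G.ends e = Δ.ends (p e)) ∧
  ∀ C : Finset E', Δ.IsCircle C → ∀ e₀ ∈ C, ∀ s : E' → E,
    (∀ f ∈ C.erase e₀, p (s f) = f) →
    ∃! t : E, p t = e₀ ∧ (C.erase e₀).image s ∪ {t} ∈ B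

/-! ## Axiomatic (synthetic) projective geometry -/

/-- An axiomatic projective geometry: a point set with a line through any two
points, unique when the points are distinct, every line having at least three
points, and satisfying the Veblen–Young axiom. -/
structure ProjGeom (P : Type*) where
  line : P → P → Set P
  line_self : ∀ p : P, line p p = {p}
  line_symm : ∀ p q : P, line p q = line q p
  left_mem_line : ∀ p q : P, p ∈ line p q
  right_mem_line : ∀ p q : P, q ∈ line p q
  line_unique : ∀ p q x y : P, p ≠ q → x ∈ line p q → y ∈ line p q → x ≠ y →
    line x y = line p q
  exists_third : ∀ p q : P, p ≠ q → ∃ r ∈ line p q, r ≠ p ∧ r ≠ q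
  veblen : ∀ p q r s x : P, p ≠ q → r ≠ s → p ≠ r → q ≠ s →
    x ∈ line p q → x ∈ line r s → ∃ y, y ∈ line p r ∧ y ∈ line q s

namespace ProjGeom

variable {P : Type*} (G : ProjGeom P)

/-- A flat (subspace): a line-closed set of points. -/
def IsFlat (t : Set P) : Prop := ∀ p ∈ t, ∀ q ∈ t, G.line p q ⊆ t

/-- The span of a point set: the smallest flat containing it. -/
def span (A : Set P) : Set P := ⋂₀ {t : Set P | G.IsFlat t ∧ A ⊆ t}

/-- An independent point set: no point is in the span of the others. -/
def Indep (A : Set P) : Prop := ∀ a ∈ A, a ∉ G.span (A \ {a})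

/-- The (matroid) rank of a point set: the largest cardinality of a finite
independent subset. -/
noncomputable def rank (A : Set P) : ℕ :=
  sSup {n : ℕ | ∃ B : Finset P, ↑B ⊆ A ∧ G.Indep ↑B ∧ B.card = n}

/-- A hyperplane: a maximal proper flat. -/
def IsHyperplane (h : Set P) : Prop :=
  G.IsFlat h ∧ h ≠ Set.univ ∧ ∀ t : Set P, G.IsFlat t → h ⊆ t → t = h ∨ t = Set.univ

/-- The codimension of a flat: the least number of hyperplanes intersecting in it. -/
noncomputable def codim (t : Set P) : ℕ :=
  sInf {n : ℕ | ∃ H : Finset (Set P), H.card = n ∧ (∀ h ∈ H, G.IsHyperplane h) ∧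
    ⋂₀ ↑H = t}

variable {N : Type*}

/-- A cross-flat with respect to an independent family `ν`: a flat containing
none of the points `ν v`. -/
def crossFlat (ν : N → P) (t : Set P) : Prop := G.IsFlat t ∧ ∀ v : N, ν v ∉ t

/-- The union of all edge lines of the independent family `ν`. -/
def edgeLineUnion (ν : N → P) : Set P :=
  ⋃ (v : N) (w : N) (_ : v ≠ w), G.line (ν v) (ν w)

/-! ### The Menelaean (point) construction for the frame matroid -/

/-- The underlying graph of the Menelaean construction `Ω(N̂, Ehat)`: a point of `Ehat`
in `N̂` is a half edge, any other point is a link joining the ends of its edge line. -/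
noncomputable def menGraph (ν : N → P) (Ehat : Set P)
    (hE : ∀ x ∈ Ehat, x ∉ Set.range ν →
      ∃ pr : N × N, pr.1 ≠ pr.2 ∧ x ∈ G.line (ν pr.1) (ν pr.2)) :
    MGraph N ↥Ehat where
  ends e :=
    if h : (e : P) ∈ Set.range ν then {(show ∃ v : N, ν v = ↑e from h).choose}
    else {(hE e e.2 h).choose.1, (hE e e.2 h).choose.2}

/-- The balanced circles of the Menelaean construction: circles whose point set
lies in a cross-flat. -/
noncomputable def menBal (ν : N → P) (Ehat : Set P)
    (hE : ∀ x ∈ Ehat, x ∉ Set.range ν →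
      ∃ pr : N × N, pr.1 ≠ pr.2 ∧ x ∈ G.line (ν pr.1) (ν pr.2)) :
    Set (Finset ↥Ehat) :=
  {C | (G.menGraph ν Ehat hE).IsCircle C ∧
    ∃ t : Set P, G.crossFlat ν t ∧ ∀ e ∈ C, (e : P) ∈ t}

/-! ### The Cevian (hyperplane) construction for the frame matroid -/

/-- A Cevian arrangement over the point basis `ν`, described by its associated
graph `Γ` and its apex function: a link `e` with endpoints `v, w` has its apex on
the edge line `v̂ŵ`, off the basis; a half edge at `v` has apex `ν v`. -/
def IsCevian {E : Type*} (ν : N → P) (Γ : MGraph N E) (apex : E → P) : Prop :=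
  ∀ e : E,
    (∃ v w : N, v ≠ w ∧ Γ.ends e = ({v, w} : Finset N) ∧
      apex e ∈ G.line (ν v) (ν w) ∧ apex e ∉ Set.range ν) ∨
    (∃ v : N, Γ.ends e = ({v} : Finset N) ∧ apex e = ν v)

/-- The apical hyperplane of an edge of a Cevian arrangement. -/
def cevHyp {E : Type*} (ν : N → P) (Γ : MGraph N E) (apex : E → P) (e : E) : Set P :=
  if Γ.IsLink e then G.span ((ν '' {u : N | u ∉ Γ.ends e}) ∪ {apex e})
  else G.span (ν '' {u : N | u ∉ Γ.ends e})

/-- The rank function of a Cevian arrangement: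
the codimension of the intersection of the corresponding apical hyperplanes. -/
noncomputable def cevRk {E : Type*} (ν : N → P) (Γ : MGraph N E) (apex : E → P)
    (S : Finset E) : ℕ :=
  G.codim (⋂ e ∈ S, G.cevHyp ν Γ apex e)

/-- The balanced circles of a Cevian arrangement:
circles of deficient hyperplane-intersection rank. -/
noncomputable def cevBal {E : Type*} (ν : N → P) (Γ : MGraph N E) (apex : E → P) :
    Set (Finset E) :=
  {C | Γ.IsCircle C ∧ G.cevRk ν Γ apex C < C.card}

/-! ### The orthographic (point) construction for the lift matroid -/

/-- The projection of the orthographic construction: each point of `Ehat` lies on the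
edge line `z'(f)e₀` of a unique edge `f` of `Δ`. -/
noncomputable def orthoProj {E' : Type*} (z' : E' → P) (e₀ : P) (Ehat : Set P)
    (hE : ∀ x ∈ Ehat, ∃ f : E', x ∈ G.line (z' f) e₀) : ↥Ehat → E' :=
  fun e => (hE e e.2).choose

/-- The underlying graph of the orthographic construction `Ω₀(Ehat)`. -/
noncomputable def orthoGraph {E' : Type*} (Δ : MGraph N E') (z' : E' → P) (e₀ : P)
    (Ehat : Set P) (hE : ∀ x ∈ Ehat, ∃ f : E', x ∈ G.line (z' f) e₀) : MGraph N ↥Ehat :=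
  ⟨fun e => Δ.ends (G.orthoProj z' e₀ Ehat hE e)⟩

/-- The balanced circles of the orthographic construction:
circles spanning a cross-flat (a flat not containing `e₀`). -/
noncomputable def orthoBal {E' : Type*} (Δ : MGraph N E') (z' : E' → P) (e₀ : P)
    (Ehat : Set P) (hE : ∀ x ∈ Ehat, ∃ f : E', x ∈ G.line (z' f) e₀) : Set (Finset ↥Ehat) :=
  {C | (G.orthoGraph Δ z' e₀ Ehat hE).IsCircle C ∧
    e₀ ∉ G.span (Subtype.val '' (↑C : Set ↥Ehat))}

end ProjGeom

/-! ### Synthetic affinographic arrangements -/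

/-- A synthetic affinographic arrangement of hyperplanes in the affine geometry
obtained from the projective geometry `G` by deleting the ideal hyperplane `hinf`:
a family of hyperplanes `hP e` (given by their projective completions, with affine
parts `hP e \ hinf`), with parallel classes indexed by the edges of a graph `Δ` with
links only via the surjection `π`; hyperplanes in the class of `f` have common
ideal part `ideal f`, and the matroid of the ideal parts (rank = codimension inside
`hinf`) is the graphic matroid of `Δ`. -/
def IsAffinographic {P N E E' : Type*} [Fintype N] (G : ProjGeom P) (hinf : Set P)
    (hP : E → Set P) (Δ : MGraph N E') (π : E → E') (ideal : E' → Set P) : Prop :=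
  G.IsHyperplane hinf ∧ (∀ f : E', Δ.IsLink f) ∧ Function.Surjective π ∧
  Function.Injective hP ∧ Function.Injective ideal ∧
  (∀ e : E, G.IsHyperplane (hP e) ∧ hP e ≠ hinf ∧ hP e ∩ hinf = ideal (π e)) ∧
  ∀ S : Finset E', Δ.graphicRk (↑S : Set E') = G.codim (hinf ∩ ⋂ f ∈ S, ideal f) - 1

/-- The underlying graph of the biased graph `Ω(A)` of an affinographic
arrangement: each edge of `Δ` is replaced by the edges of its parallel class. -/
def affinoGraph {N E E' : Type*} (Δ : MGraph N E') (π : E → E') : MGraph N E :=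
  ⟨fun e => Δ.ends (π e)⟩

/-- The affine intersection `t_A(S)` of the hyperplanes of `S`. -/
def affInter {P E : Type*} (hinf : Set P) (hP : E → Set P) (S : Set E) : Set P :=
  ⋂ e ∈ S, (hP e \ hinf)

/-- The balanced circles of `Ω(A)`: digons over a single edge of `Δ` are unbalanced;
any other circle is balanced iff its affine intersection is nonempty. -/
def affinoBal {P N E E' : Type*} (_G : ProjGeom P) (hinf : Set P) (hP : E → Set P)
    (Δ : MGraph N E') (π : E → E') : Set (Finset E) :=
  {C | (affinoGraph Δ π).IsCircle C ∧ ¬(∃ f : E', ∀ e ∈ C, π e = f) ∧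
    (affInter hinf hP ↑C).Nonempty}

/-! ### Coordinatized projective spaces -/

/-- The rank of a finite set of points of a coordinatized projective space:
the dimension of the linear span of representative vectors. -/
noncomputable def projRank (F : Type*) {V : Type*} [DivisionRing F] [AddCommGroup V]
    [Module F V] (A : Finset (Projectivization F V)) : ℕ :=
  Module.finrank F ↥(Submodule.span F (Projectivization.rep '' (↑A : Set (Projectivization F V))))

/-- The edge set of the full biased graph `Ω^•`: the edges of `Ω` together with a
new half edge at every node not already supporting one. -/
def FullE {N E : Type*} (Ω : BiasedGraph N E) : Type _ :=
  E ⊕ {v : N // ∀ e : E, Ω.ends e ≠ ({v} : Finset N)}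

/-- The underlying graph of the full biased graph `Ω^•`. -/
def fullGraph {N E : Type*} (Ω : BiasedGraph N E) : MGraph N (FullE Ω) :=
  ⟨Sum.elim Ω.ends (fun v => {v.val})⟩

/-- The balanced circles of the full biased graph `Ω^•` (circles avoid half edges). -/
def fullBal {N E : Type*} (Ω : BiasedGraph N E) : Set (Finset (FullE Ω)) :=
  {C | ∃ C₀ ∈ Ω.Bal, C = C₀.image Sum.inl}

namespace Aff

section geom
variable {P : Type*} {G : ProjGeom P}

theorem line_eq_left {p q x : P} (hx : x ∈ G.line p q) (hxp : x ≠ p) :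
    G.line p x = G.line p q := by
  by_cases hpq : p = q
  · subst hpq
    rw [G.line_self] at hx
    exact absurd hx hxp
  · exact G.line_unique p q p x hpq (G.left_mem_line p q) hx hxp.symm

theorem mem_line_swap {p q x : P} (hx : x ∈ G.line p q) (hxp : x ≠ p) :
    q ∈ G.line p x := by
  rw [line_eq_left hx hxp]; exact G.right_mem_line p q

theorem cone_flat {h : Set P} (hf : G.IsFlat h) {p : P} (hp : p ∉ h) :
    G.IsFlat {y | y = p ∨ ∃ x ∈ h, y ∈ G.line p x} := by
  have ne : ∀ x ∈ h, x ≠ p := fun x hx e => hp (e ▸ hx)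
  have key : ∀ V w, V ∈ h → V ∈ G.line p w →
      w ∈ {y | y = p ∨ ∃ x ∈ h, y ∈ G.line p x} := by
    intro V w hV hw
    exact Or.inr ⟨V, hV, mem_line_swap hw (ne V hV)⟩
  have base : ∀ z ∈ {y | y = p ∨ ∃ x ∈ h, y ∈ G.line p x}, 
      G.line p z ⊆ {y | y = p ∨ ∃ x ∈ h, y ∈ G.line p x} := by
    intro z hz w hw
    by_cases hzp : z = p
    · subst hzp
      rw [G.line_self] at hw
      exact Or.inl hw
    · rcases hz with hz | ⟨x, hx, hz⟩
      · exact absurd hz hzp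
      · rw [line_eq_left hz hzp] at hw
        exact Or.inr ⟨x, hx, hw⟩
  intro y hy z hz w hw
  by_cases hyp : y = p
  · subst hyp; exact base z hz hw
  by_cases hzp : z = p
  · subst hzp; rw [G.line_symm] at hw; exact base y hy hw
  by_cases hwp : w = p
  · exact Or.inl hwp
  by_cases hyz : y = z
  · subst hyz; rw [G.line_self] at hw; rw [hw]; exact hy
  by_cases hwy : w = y
  · rw [hwy]; exact hy
  by_cases hwz : w = z
  · rw [hwz]; exact hz
  have hy' := hy
  have hz' := hz
  rcases hy with hy | ⟨x, hx, hy⟩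
  · exact absurd hy hyp
  rcases hz with hz | ⟨x', hx', hz⟩
  · exact absurd hz hzp
  by_cases hxx : x = x'
  · subst hxx
    rw [G.line_unique p x y z (ne x hx).symm hy hz hyz] at hw
    exact Or.inr ⟨x, hx, hw⟩
  by_cases hxy : x = y
  · subst hxy
    have hz2 : z ∈ G.line w x := by
      rw [G.line_unique x z w x hyz hw (G.left_mem_line _ _) hwy]
      exact G.right_mem_line _ _
    obtain ⟨V, hV1, hV2⟩ := G.veblen p x' w x z (ne x' hx').symm hwy (Ne.symm hwp)
      (Ne.symm hxx) hz hz2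
    exact key V w (hf x' hx' x hx hV2) hV1
  by_cases hxz : x' = z
  · subst hxz
    have hy2 : y ∈ G.line w x' := by
      rw [G.line_unique y x' w x' hyz hw (G.right_mem_line _ _) hwz]
      exact G.left_mem_line _ _
    obtain ⟨V, hV1, hV2⟩ := G.veblen p x w x' y (ne x hx).symm hwz (Ne.symm hwp)
      hxx hy hy2
    exact key V w (hf x hx x' hx' hV2) hV1
  have hp1 : p ∈ G.line x y := by
    rw [G.line_unique p x x y (ne x hx).symm (G.right_mem_line _ _) hy hxy]
    exact G.left_mem_line _ _
  have hp2 : p ∈ G.line x' z := by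
    rw [G.line_unique p x' x' z (ne x' hx').symm (G.right_mem_line _ _) hz hxz]
    exact G.left_mem_line _ _
  obtain ⟨Y, hY1, hY2⟩ := G.veblen x y x' z p hxy hxz hxx hyz hp1 hp2
  have hYh := hf x hx x' hx' hY1
  by_cases hwY : w = Y
  · subst hwY; exact key w w hYh (G.right_mem_line _ _)
  by_cases hxY : x = Y
  · subst hxY
    have : G.line y z = G.line x y := by
      rw [G.line_symm x y]; exact (line_eq_left hY2 hxy).symm
    rw [this, G.line_unique p x x y (ne x hx).symm (G.right_mem_line _ _) hy hxy] at hw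
    exact Or.inr ⟨x, hx, hw⟩
  have hy2 : y ∈ G.line w Y := by
    rw [G.line_unique y z w Y hyz hw hY2 hwY]; exact G.left_mem_line _ _
  obtain ⟨V, hV1, hV2⟩ := G.veblen p x w Y y (ne x hx).symm hwY (Ne.symm hwp) hxY hy hy2
  exact key V w (hf x hx Y hYh hV2) hV1

theorem hyp_meets {h : Set P} (hh : G.IsHyperplane h) {p q : P} (hp : p ∉ h)
    (hpq : p ≠ q) : ∃ x ∈ h, x ∈ G.line p q := by
  obtain ⟨hf, _, hmax⟩ := hh
  rcases hmax _ (cone_flat hf hp) (fun x hx => Or.inr ⟨x, hx, G.right_mem_line p x⟩) with h1 | h1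
  · exact absurd (h1 ▸ (Or.inl rfl : p ∈ {y | y = p ∨ ∃ x ∈ h, y ∈ G.line p x})) hp
  · have : q ∈ {y | y = p ∨ ∃ x ∈ h, y ∈ G.line p x} := h1 ▸ Set.mem_univ q
    rcases this with h2 | ⟨x, hx, h2⟩
    · exact absurd h2.symm hpq
    · exact ⟨x, hx, mem_line_swap h2 hpq.symm⟩

/-- Exchange property of hyperplanes. -/
theorem exch {t h h' : Set P} (ht : G.IsFlat t) (hh : G.IsHyperplane h)
    (hh' : G.IsHyperplane h') (h1 : t ∩ h ⊆ h') (h2 : ¬ t ⊆ h') : t ∩ h' ⊆ h := by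
  rintro q ⟨hqt, hqh'⟩
  by_contra hqh
  obtain ⟨p, hpt, hp⟩ := Set.not_subset.1 h2
  have hpq : p ≠ q := fun e => hp (e ▸ hqh')
  have hph : p ∉ h := fun e => hp (h1 ⟨hpt, e⟩)
  obtain ⟨x, hx, hxl⟩ := hyp_meets hh hph hpq
  have hxh' := h1 ⟨ht p hpt q hqt hxl, hx⟩
  have hxq : x ≠ q := fun e => hqh (e ▸ hx)
  have := G.line_unique p q x q hpq hxl (G.right_mem_line _ _) hxq
  exact hp (hh'.1 x hxh' q hqh' (this ▸ G.left_mem_line p q))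

theorem flat_inter {s t : Set P} (hs : G.IsFlat s) (ht : G.IsFlat t) : G.IsFlat (s ∩ t) :=
  fun p hp q hq _ hx => ⟨hs p hp.1 q hq.1 hx, ht p hp.2 q hq.2 hx⟩

theorem flat_sInter {K : Set (Set P)} (hK : ∀ k ∈ K, G.IsFlat k) : G.IsFlat (⋂₀ K) :=
  fun p hp q hq _ hx k hk => hK k hk p (hp k hk) q (hq k hk) hx

theorem flat_univ : G.IsFlat (Set.univ : Set P) := fun _ _ _ _ _ _ => trivial

inductive HC (G : ProjGeom P) : Set P → Set P → ℕ → Prop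
  | nil (t) : HC G t t 0
  | cons {t s h : Set P} {n : ℕ} : G.IsHyperplane h → ¬ t ⊆ h → HC G (t ∩ h) s n → HC G t s (n+1)

theorem HC.snoc {t s h : Set P} {n : ℕ} (hc : HC G t s n) (hh : G.IsHyperplane h) (hs : ¬ s ⊆ h) :
    HC G t (s ∩ h) (n+1) := by
  induction hc with
  | nil t => exact HC.cons hh hs (HC.nil _)
  | cons a b _ ih => exact HC.cons a b (ih hs)

theorem HC.steinitz {t s : Set P} {n : ℕ} (hc : HC G t s n) (ht : G.IsFlat t) :
    ∀ K : Finset (Set P), (∀ k ∈ K, G.IsHyperplane k) → t ∩ ⋂₀ ↑K ⊆ s → n ≤ K.card := by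
  induction hc with
  | nil t => intros; omega
  | @cons t s h n hh hth hc ih =>
    intro K hK hs
    have hsub : s ⊆ h := by
      have : ∀ {a b : Set P} {m}, HC G a b m → b ⊆ a := by
        intro a b m hab
        induction hab with
        | nil => exact subset_rfl
        | cons _ _ _ ih => exact ih.trans Set.inter_subset_left
      exact (this hc).trans Set.inter_subset_right
    -- maximal K'
    obtain ⟨K', hK', hmax⟩ := Finset.exists_max_image
      (K.powerset.filter (fun K' : Finset (Set P) => ¬ (t ∩ ⋂₀ (↑K' : Set (Set P)) ⊆ h))) Finset.card
      ⟨∅, by simp [hth]⟩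
    simp only [Finset.mem_filter, Finset.mem_powerset] at hK' hmax
    have hne : ¬ K ⊆ K' := by
      intro hKK
      have := Finset.Subset.antisymm hKK hK'.1
      subst this
      exact hK'.2 (hs.trans hsub)
    obtain ⟨k, hkK, hkK'⟩ := Finset.not_subset.1 hne
    have h1 : t ∩ ⋂₀ (↑(insert k K') : Set (Set P)) ⊆ h := by
      by_contra hcon
      have := hmax (insert k K') ⟨Finset.insert_subset hkK hK'.1, hcon⟩
      rw [Finset.card_insert_of_notMem hkK'] at this
      omega
    have hfl : G.IsFlat (t ∩ ⋂₀ (↑K' : Set (Set P))) :=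
      flat_inter ht (flat_sInter fun k hk => (hK k (hK'.1 hk)).1)
    have h2 : (t ∩ ⋂₀ (↑K' : Set (Set P))) ∩ h ⊆ k := by
      refine exch hfl (hK k hkK) hh ?_ hK'.2
      refine subset_trans ?_ h1
      rw [Finset.coe_insert, Set.sInter_insert]
      rintro x ⟨⟨a, b⟩, c⟩
      exact ⟨a, c, b⟩
    have := ih (flat_inter ht hh.1) (K.erase k) (fun j hj => hK j (Finset.mem_of_mem_erase hj)) (by
      refine subset_trans ?_ hs
      rintro x ⟨⟨a, b⟩, c⟩
      refine ⟨a, ?_⟩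
      have hxk : x ∈ k := h2 ⟨⟨a, fun j hj => c j (by
        simp only [Finset.coe_erase, Set.mem_sdiff, Finset.mem_coe, Set.mem_singleton_iff]
        exact ⟨hK'.1 hj, fun e => hkK' (e ▸ hj)⟩)⟩, b⟩
      intro j hj
      by_cases hjk : j = k
      · rw [hjk]; exact hxk
      · exact c j (by simp only [Finset.coe_erase, Set.mem_sdiff, Finset.mem_coe, Set.mem_singleton_iff]; exact ⟨hj, hjk⟩))
    rw [Finset.card_erase_of_mem hkK] at this
    have := Finset.card_pos.2 ⟨k, hkK⟩
    omega

theorem HC.greedy (H : Finset (Set P)) (hH : ∀ h ∈ H, G.IsHyperplane h) :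
    ∀ t : Set P, ∃ n, HC G t (t ∩ ⋂₀ ↑H) n := by
  induction H using Finset.induction_on with
  | empty => intro t; exact ⟨0, by simpa using HC.nil t⟩
  | insert h H _ ih =>
    intro t
    have ih := ih (fun k hk => hH k (Finset.mem_insert_of_mem hk))
    rw [Finset.coe_insert, Set.sInter_insert, ← Set.inter_assoc]
    by_cases hth : t ⊆ h
    · rw [Set.inter_eq_left.2 hth]; exact ih t
    · obtain ⟨n, hn⟩ := ih (t ∩ h)
      exact ⟨n+1, HC.cons (hH h (Finset.mem_insert_self _ _)) hth hn⟩

theorem HC.exists_finset {t s : Set P} {n : ℕ} (hc : HC G t s n) :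
    ∃ H : Finset (Set P), H.card ≤ n ∧ (∀ h ∈ H, G.IsHyperplane h) ∧ t ∩ ⋂₀ ↑H = s := by
  induction hc with
  | nil t => exact ⟨∅, by simp⟩
  | @cons t s h n hh _ _ ih =>
    obtain ⟨H, h1, h2, h3⟩ := ih
    refine ⟨insert h H, (Finset.card_insert_le _ _).trans (by omega), ?_, ?_⟩
    · intro k hk
      rcases Finset.mem_insert.1 hk with rfl | hk
      · exact hh
      · exact h2 k hk
    · rw [Finset.coe_insert, Set.sInter_insert, ← Set.inter_assoc]; exact h3

theorem codim_inter {H : Finset (Set P)} (hH : ∀ h ∈ H, G.IsHyperplane h) {h : Set P}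
    (hh : G.IsHyperplane h)
    (hc : G.codim (⋂₀ ↑H ∩ h) ≤ G.codim (⋂₀ ↑H)) : ⋂₀ ↑H ⊆ h := by
  by_contra hcon
  obtain ⟨n, hn⟩ := HC.greedy H hH Set.univ
  rw [Set.univ_inter] at hn
  obtain ⟨H', h1, h2, h3⟩ := hn.exists_finset
  rw [Set.univ_inter] at h3
  have hle : G.codim (⋂₀ ↑H) ≤ H'.card := Nat.sInf_le ⟨H', rfl, h2, h3⟩
  have hmem : G.codim (⋂₀ ↑H ∩ h) ∈ {n : ℕ | ∃ K : Finset (Set P), K.card = n ∧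
      (∀ h ∈ K, G.IsHyperplane h) ∧ ⋂₀ ↑K = ⋂₀ (↑H : Set (Set P)) ∩ h} := by
    refine Nat.sInf_mem ⟨_, insert h H, rfl, ?_, ?_⟩
    · intro k hk
      rcases Finset.mem_insert.1 hk with rfl | hk
      · exact hh
      · exact hH k hk
    · rw [Finset.coe_insert, Set.sInter_insert, Set.inter_comm]
  obtain ⟨K, hK1, hK2, hK3⟩ := hmem
  have := (hn.snoc hh hcon).steinitz flat_univ K hK2 (by rw [hK3, Set.univ_inter])
  omega

theorem codim_pos {H : Finset (Set P)} (hH : ∀ h ∈ H, G.IsHyperplane h)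
    (hu : ⋂₀ (↑H : Set (Set P)) ≠ Set.univ) : 1 ≤ G.codim (⋂₀ ↑H) := by
  by_contra hcon
  have h0 : G.codim (⋂₀ ↑H) = 0 := by omega
  have hmem : G.codim (⋂₀ ↑H) ∈ {n : ℕ | ∃ K : Finset (Set P), K.card = n ∧
      (∀ h ∈ K, G.IsHyperplane h) ∧ ⋂₀ ↑K = ⋂₀ (↑H : Set (Set P))} :=
    Nat.sInf_mem ⟨_, H, rfl, hH, rfl⟩
  obtain ⟨K, hK1, hK2, hK3⟩ := hmem
  rw [h0, Finset.card_eq_zero] at hK1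
  subst hK1
  simp at hK3
  exact hu hK3.symm

theorem subset_of_diff {t h h' : Set P} (ht : G.IsFlat t) (hh : G.IsHyperplane h)
    (hh' : G.IsHyperplane h') (h1 : ¬ t ⊆ h) (h2 : t \ h ⊆ h') : t ⊆ h' := by
  intro q hq
  by_cases hqh : q ∈ h
  · obtain ⟨p, hpt, hp⟩ := Set.not_subset.1 h1
    have hpq : p ≠ q := fun e => hp (e ▸ hqh)
    obtain ⟨r, hr, hrp, hrq⟩ := G.exists_third p q hpq
    have hrh : r ∉ h := by
      intro hrh
      have := G.line_unique p q r q hpq hr (G.right_mem_line _ _) hrq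
      exact hp (hh.1 r hrh q hqh (this ▸ G.left_mem_line p q))
    have h3 : p ∈ h' := h2 ⟨hpt, hp⟩
    have h4 : r ∈ h' := h2 ⟨ht p hpt q hq hr, hrh⟩
    exact hh'.1 p h3 r h4 (mem_line_swap hr hrp)
  · exact h2 ⟨hq, hqh⟩

end geom

theorem rtg_mono {α : Type*} {r s : α → α → Prop} (h : ∀ a b, r a b → s a b) {a b : α}
    (hab : Relation.ReflTransGen r a b) : Relation.ReflTransGen s a b := by
  induction hab with
  | refl => exact Relation.ReflTransGen.refl
  | tail _ h2 ih => exact ih.tail (h _ _ h2)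

theorem rtg_symm {α : Type*} {r : α → α → Prop} (h : ∀ a b, r a b → r b a) {a b : α}
    (hab : Relation.ReflTransGen r a b) : Relation.ReflTransGen r b a := by
  induction hab with
  | refl => exact Relation.ReflTransGen.refl
  | tail _ h2 ih => exact Relation.ReflTransGen.head (h _ _ h2) ih

section graph
variable {N E : Type*} {Γ : MGraph N E}

theorem conn_symm {S : Set E} {a b : N} (h : Γ.nodeConn S a b) : Γ.nodeConn S b a := by
  refine rtg_symm ?_ h
  rintro x y ⟨e, he, hx, hy⟩
  exact ⟨e, he, hy, hx⟩

theorem conn_mono {S T : Set E} (hST : S ⊆ T) {a b : N} (h : Γ.nodeConn S a b) :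
    Γ.nodeConn T a b :=
  rtg_mono (fun _ _ ⟨e, he, hx⟩ => ⟨e, hST he, hx⟩) h

def Cn (Γ : MGraph N E) (S : Set E) (e : E) : Prop :=
  ∀ a ∈ Γ.ends e, ∀ b ∈ Γ.ends e, Γ.nodeConn S a b

theorem Cn.mono {S T : Set E} (hST : S ⊆ T) {e : E} (h : Cn Γ S e) : Cn Γ T e :=
  fun a ha b hb => conn_mono hST (h a ha b hb)

theorem Cn.of_mem {S : Set E} {e : E} (h : e ∈ S) : Cn Γ S e :=
  fun _ ha _ hb => Relation.ReflTransGen.single ⟨e, h, ha, hb⟩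

theorem conn_insert {S : Set E} {e : E} (h : Cn Γ S e) {a b : N}
    (hab : Γ.nodeConn (insert e S) a b) : Γ.nodeConn S a b := by
  induction hab with
  | refl => exact Relation.ReflTransGen.refl
  | tail _ hbc ih =>
    obtain ⟨f, hf, h1, h2⟩ := hbc
    rcases hf with rfl | hf
    · exact ih.trans (h _ h1 _ h2)
    · exact ih.tail ⟨f, hf, h1, h2⟩

theorem rk_eq [Fintype N] {S : Set E} {e : E} (h : Cn Γ S e) :
    Γ.graphicRk (insert e S) = Γ.graphicRk S := by
  have : Γ.components (insert e S) = Γ.components S := by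
    have h1 : ∀ u v, Γ.nodeConn (insert e S) u v ↔ Γ.nodeConn S u v :=
      fun u v => ⟨conn_insert h, conn_mono (Set.subset_insert _ _)⟩
    simp only [MGraph.components, h1]
  simp only [MGraph.graphicRk, MGraph.numComponents, this]

theorem comp_le [Fintype N] (S : Set E) : Γ.numComponents S ≤ Fintype.card N := by
  have : Γ.components S = Set.range (fun v => {u | Γ.nodeConn S u v}) := by
    ext W; simp [MGraph.components, eq_comm]
  rw [MGraph.numComponents, this, ← Nat.card_eq_fintype_card]
  exact Finite.card_range_le _

theorem rk_lt [Fintype N] {S : Set E} {e : E} (h : ¬ Cn Γ S e) :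
    Γ.graphicRk S < Γ.graphicRk (insert e S) := by
  have hlt : Γ.numComponents (insert e S) < Γ.numComponents S := by
    unfold Cn at h
    push Not at h
    obtain ⟨a, ha, b, hb, hab⟩ := h
    let φ : Set N → Set N := fun W => {u | ∃ w ∈ W, Γ.nodeConn (insert e S) u w}
    have hφ : ∀ v, φ {u | Γ.nodeConn S u v} = {u | Γ.nodeConn (insert e S) u v} := by
      intro v; ext u
      constructor
      · rintro ⟨w, hw, huw⟩
        exact huw.trans (conn_mono (Set.subset_insert _ _) hw)
      · intro hu
        exact ⟨v, Relation.ReflTransGen.refl, hu⟩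
    have himg : Γ.components (insert e S) = φ '' Γ.components S := by
      ext W
      constructor
      · rintro ⟨v, rfl⟩
        exact ⟨_, ⟨v, rfl⟩, hφ v⟩
      · rintro ⟨_, ⟨v, rfl⟩, rfl⟩
        exact ⟨v, hφ v⟩
    have hfin : (Γ.components S).Finite := Set.toFinite _
    have hnc : ∀ T, Γ.numComponents T = (Γ.components T).ncard := fun T => rfl
    rw [hnc, hnc, himg]
    refine lt_of_le_of_ne (Set.ncard_image_le hfin) ?_
    intro heq
    have hinj := (Set.ncard_image_iff hfin).1 heq
    have h2 : {u | Γ.nodeConn S u a} = {u | Γ.nodeConn S u b} := by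
      refine hinj ⟨a, rfl⟩ ⟨b, rfl⟩ ?_
      rw [hφ, hφ]
      have hc : Γ.nodeConn (insert e S) a b :=
        Relation.ReflTransGen.single ⟨e, Set.mem_insert _ _, ha, hb⟩
      ext u
      exact ⟨fun h => h.trans hc, fun h => h.trans (conn_symm hc)⟩
    have : a ∈ {u | Γ.nodeConn S u a} := Relation.ReflTransGen.refl
    rw [h2] at this
    exact hab this
  have := comp_le (Γ := Γ) S
  simp only [MGraph.graphicRk]
  omega

theorem rk_mono_ins [Fintype N] (S : Set E) (e : E) :
    Γ.graphicRk S ≤ Γ.graphicRk (insert e S) := by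
  by_cases h : Cn Γ S e
  · exact (rk_eq h).ge
  · exact (rk_lt h).le

/-! degrees -/

theorem mem_nodes {S : Finset E} {v : N} : v ∈ Γ.nodesOf S ↔ ∃ e ∈ S, v ∈ Γ.ends e := by
  simp [MGraph.nodesOf]

theorem deg_zero {S : Finset E} {v : N} (h : v ∉ Γ.nodesOf S) : Γ.degreeIn S v = 0 := by
  rw [MGraph.degreeIn, Finset.card_eq_zero, Finset.filter_eq_empty_iff]
  intro e he hv
  exact h (mem_nodes.2 ⟨e, he, hv⟩)

theorem deg_union {S T : Finset E} (h : Disjoint S T) (v : N) :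
    Γ.degreeIn (S ∪ T) v = Γ.degreeIn S v + Γ.degreeIn T v := by
  rw [MGraph.degreeIn, Finset.filter_union, Finset.card_union_of_disjoint]
  · rfl
  · exact Finset.disjoint_filter_filter h

theorem deg_single {e : E} (v : N) :
    Γ.degreeIn {e} v = if v ∈ Γ.ends e then 1 else 0 := by
  rw [MGraph.degreeIn, Finset.filter_singleton]
  split_ifs <;> simp

theorem nodes_union {S T : Finset E} {v : N} :
    v ∈ Γ.nodesOf (S ∪ T) ↔ v ∈ Γ.nodesOf S ∨ v ∈ Γ.nodesOf T := by
  simp only [mem_nodes, Finset.mem_union]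
  constructor
  · rintro ⟨e, he | he, hv⟩
    · exact Or.inl ⟨e, he, hv⟩
    · exact Or.inr ⟨e, he, hv⟩
  · rintro (⟨e, he, hv⟩ | ⟨e, he, hv⟩)
    · exact ⟨e, Or.inl he, hv⟩
    · exact ⟨e, Or.inr he, hv⟩

theorem connE_union {S T : Finset E} (hS : Γ.ConnEdges ↑S) (hT : Γ.ConnEdges ↑T) {v : N}
    (h1 : v ∈ Γ.nodesOf S) (h2 : v ∈ Γ.nodesOf T) : Γ.ConnEdges ↑(S ∪ T) := by
  obtain ⟨s, hs, hvs⟩ := mem_nodes.1 h1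
  obtain ⟨t, ht, hvt⟩ := mem_nodes.1 h2
  have mS : ∀ a ∈ S, a ∈ (↑(S ∪ T) : Set E) := fun a ha => by simp [ha]
  have mT : ∀ a ∈ T, a ∈ (↑(S ∪ T) : Set E) := fun a ha => by simp [ha]
  have key : ∀ e ∈ S ∪ T, Relation.ReflTransGen
      (fun a b => a ∈ (↑(S ∪ T) : Set E) ∧ b ∈ (↑(S ∪ T) : Set E) ∧
        ∃ v : N, v ∈ Γ.ends a ∧ v ∈ Γ.ends b) e s := by
    intro e he
    rcases Finset.mem_union.1 he with he | he
    · exact rtg_mono (fun a b h => ⟨mS a h.1, mS b h.2.1, h.2.2⟩) (hS e he s hs)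
    · refine Relation.ReflTransGen.tail (rtg_mono
        (fun a b h => ⟨mT a h.1, mT b h.2.1, h.2.2⟩) (hT e he t ht))
        ⟨mT t ht, mS s hs, v, hvt, hvs⟩
  intro e he f hf
  refine (key e he).trans (rtg_symm ?_ (key f hf))
  rintro a b ⟨h1, h2, v, h3, h4⟩
  exact ⟨h2, h1, v, h4, h3⟩

theorem circle_of_paths {P Q : Finset E} {u v : N} (hP : Γ.IsPath P u v) (hQ : Γ.IsPath Q u v)
    (hd : Disjoint P Q) (hn : (↑(Γ.nodesOf P) ∩ ↑(Γ.nodesOf Q) : Set N) = {u, v}) :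
    Γ.IsCircle (P ∪ Q) := by
  obtain ⟨p1, p2, p3, p4, p5, p6, p7, p8, p9⟩ := hP
  obtain ⟨q1, q2, q3, q4, q5, q6, q7, q8, q9⟩ := hQ
  refine ⟨p1.mono Finset.subset_union_left, ?_, connE_union p4 q4 p5 q5, ?_⟩
  · intro e he
    rcases Finset.mem_union.1 he with he | he
    exacts [p3 e he, q3 e he]
  · intro w hw
    rw [deg_union hd]
    by_cases hwu : w = u
    · subst hwu; omega
    by_cases hwv : w = v
    · subst hwv; omega
    have hnot : ¬ (w ∈ Γ.nodesOf P ∧ w ∈ Γ.nodesOf Q) := by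
      intro h
      have : w ∈ (↑(Γ.nodesOf P) ∩ ↑(Γ.nodesOf Q) : Set N) := h
      rw [hn] at this
      rcases this with h | h
      exacts [hwu h, hwv h]
    by_cases hwP : w ∈ Γ.nodesOf P
    · rw [p9 w hwP hwu hwv, deg_zero (fun h => hnot ⟨hwP, h⟩)]
    · rw [deg_zero hwP, q9 w ((nodes_union.1 hw).resolve_left hwP) hwu hwv]

theorem path_single {e : E} {u v : N} (huv : u ≠ v) (he : Γ.ends e = {u, v}) :
    Γ.IsPath {e} u v := by
  refine ⟨Finset.singleton_nonempty _, huv, ?_, ?_, ?_, ?_, ?_, ?_, ?_⟩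
  · intro f hf
    rw [Finset.mem_singleton.1 hf, MGraph.IsLink, he, Finset.card_pair huv]
  · intro a ha b hb
    simp at ha hb
    subst ha; subst hb
    exact Relation.ReflTransGen.refl
  · exact mem_nodes.2 ⟨e, by simp, by simp [he]⟩
  · exact mem_nodes.2 ⟨e, by simp, by simp [he]⟩
  · simp [deg_single, he]
  · simp [deg_single, he]
  · intro w hw h1 h2
    obtain ⟨f, hf, hwf⟩ := mem_nodes.1 hw
    rw [Finset.mem_singleton.1 hf, he] at hwf
    simp [h1, h2] at hwf

theorem path_cons {e : E} {Q : Finset E} {a c b : N} (hac : a ≠ c) (he : Γ.ends e = {a, c})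
    (hQ : Γ.IsPath Q c b) (ha : a ∉ Γ.nodesOf Q) : Γ.IsPath ({e} ∪ Q) a b := by
  obtain ⟨q1, q2, q3, q4, q5, q6, q7, q8, q9⟩ := hQ
  obtain ⟨p1, p2, p3, p4, p5, p6, p7, p8, p9⟩ := path_single hac he
  have hab : a ≠ b := fun h => ha (h ▸ q6)
  have hd : Disjoint {e} Q := by
    rw [Finset.disjoint_singleton_left]
    intro h
    exact ha (mem_nodes.2 ⟨e, h, by simp [he]⟩)
  refine ⟨p1.mono Finset.subset_union_left, hab, ?_, connE_union p4 q4 p6 q5,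
    nodes_union.2 (Or.inl p5), nodes_union.2 (Or.inr q6), ?_, ?_, ?_⟩
  · intro f hf
    rcases Finset.mem_union.1 hf with h | h
    exacts [p3 f h, q3 f h]
  · rw [deg_union hd, p7, deg_zero ha]
  · rw [deg_union hd, q8, deg_single, he]
    simp [hab.symm, q2.symm]
  · intro w hw hwa hwb
    rw [deg_union hd]
    by_cases hwc : w = c
    · subst hwc; omega
    · rw [deg_single, he]
      have : w ∈ Γ.nodesOf Q := by
        rcases nodes_union.1 hw with h | h
        · obtain ⟨f, hf, hwf⟩ := mem_nodes.1 h
          rw [Finset.mem_singleton.1 hf, he] at hwf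
          simp [hwa, hwc] at hwf
        · exact h
      rw [q9 w this hwc hwb]
      simp [hwa, hwc]

inductive SP (Γ : MGraph N E) (b : N) : N → Finset E → Prop
  | single {e : E} {a : N} : a ≠ b → Γ.ends e = {a, b} → SP Γ b a {e}
  | cons {e : E} {a c : N} {Q : Finset E} : a ≠ c → Γ.ends e = {a, c} → SP Γ b c Q →
      a ∉ Γ.nodesOf Q → SP Γ b a ({e} ∪ Q)

theorem SP.path {a b : N} {Q : Finset E} (h : SP Γ b a Q) : Γ.IsPath Q a b := by
  induction h with
  | single h1 h2 => exact path_single h1 h2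
  | cons h1 h2 _ h3 ih => exact path_cons h1 h2 ih h3

theorem SP.trunc {a b : N} {Q : Finset E} (h : SP Γ b a Q) :
    ∀ x ∈ Γ.nodesOf Q, x ≠ b → ∃ Q' ⊆ Q, SP Γ b x Q' := by
  induction h with
  | @single e a h1 h2 =>
    intro x hx hxb
    obtain ⟨f, hf, hxf⟩ := mem_nodes.1 hx
    rw [Finset.mem_singleton.1 hf, h2] at hxf
    simp [hxb] at hxf
    subst hxf
    exact ⟨{e}, subset_rfl, SP.single h1 h2⟩
  | @cons e a c Q h1 h2 h3 h4 ih =>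
    intro x hx hxb
    rcases nodes_union.1 hx with h | h
    · obtain ⟨f, hf, hxf⟩ := mem_nodes.1 h
      rw [Finset.mem_singleton.1 hf, h2] at hxf
      simp at hxf
      rcases hxf with rfl | rfl
      · exact ⟨_, subset_rfl, SP.cons h1 h2 h3 h4⟩
      · exact ⟨Q, Finset.subset_union_right, h3⟩
    · obtain ⟨Q', hQ', h⟩ := ih x h hxb
      exact ⟨Q', hQ'.trans Finset.subset_union_right, h⟩

theorem ends_pair {e : E} (he : Γ.IsLink e) {a c : N} (ha : a ∈ Γ.ends e) (hc : c ∈ Γ.ends e)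
    (hac : a ≠ c) : Γ.ends e = {a, c} := by
  symm
  apply Finset.eq_of_subset_of_card_le
  · intro x hx
    simp at hx
    rcases hx with rfl | rfl <;> assumption
  · rw [Finset.card_pair hac]; exact he.le

theorem SP.exists {S : Set E} (hS : ∀ e ∈ S, Γ.IsLink e) {a b : N} (h : Γ.nodeConn S a b) :
    a ≠ b → ∃ Q : Finset E, ↑Q ⊆ S ∧ SP Γ b a Q := by
  induction h using Relation.ReflTransGen.head_induction_on with
  | refl => intro h; exact absurd rfl h
  | @head a c hac hcb ih =>
    intro hab
    obtain ⟨e, he, h1, h2⟩ := hac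
    by_cases hac : a = c
    · subst hac; exact ih hab
    have hends := ends_pair (hS e he) h1 h2 hac
    by_cases hcb' : c = b
    · subst hcb'
      exact ⟨{e}, by simpa using he, SP.single hab hends⟩
    obtain ⟨Q, hQ, hsp⟩ := ih hcb'
    by_cases haQ : a ∈ Γ.nodesOf Q
    · obtain ⟨Q', hQ', h⟩ := hsp.trunc a haQ hab
      exact ⟨Q', (Finset.coe_subset.2 hQ').trans hQ, h⟩
    · refine ⟨{e} ∪ Q, ?_, SP.cons hac hends hsp haQ⟩
      rw [Finset.coe_union, Finset.coe_singleton]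
      exact Set.union_subset (by simpa using he) hQ

theorem exists_circle {S : Set E} (hS : ∀ e ∈ S, Γ.IsLink e) {e : E} (hl : Γ.IsLink e)
    (heS : e ∉ S) (hc : Cn Γ S e) :
    ∃ C : Finset E, ↑C ⊆ insert e S ∧ e ∈ C ∧ Γ.IsCircle C := by
  obtain ⟨a, b, hab, he⟩ := Finset.card_eq_two.1 hl
  obtain ⟨Q, hQ, hsp⟩ := SP.exists hS (hc a (by simp [he]) b (by simp [he])) hab
  have hp := hsp.path
  refine ⟨{e} ∪ Q, ?_, by simp, circle_of_paths (path_single hab he) hp ?_ ?_⟩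
  · rw [Finset.coe_union, Finset.coe_singleton]
    exact Set.union_subset (by simp) (hQ.trans (Set.subset_insert _ _))
  · rw [Finset.disjoint_singleton_left]
    exact fun h => heS (hQ h)
  · ext x
    simp only [Set.mem_inter_iff, Finset.mem_coe, Set.mem_insert_iff, Set.mem_singleton_iff]
    constructor
    · rintro ⟨h, _⟩
      obtain ⟨f, hf, hxf⟩ := mem_nodes.1 h
      rw [Finset.mem_singleton.1 hf, he] at hxf
      simpa using hxf
    · have h5 := hp.2.2.2.2.1
      have h6 := hp.2.2.2.2.2.1
      rintro (rfl | rfl)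
      · exact ⟨mem_nodes.2 ⟨e, by simp, by simp [he]⟩, h5⟩
      · exact ⟨mem_nodes.2 ⟨e, by simp, by simp [he]⟩, h6⟩

theorem circle_deg {C : Finset E} (hC : Γ.IsCircle C) (v : N) : Even (Γ.degreeIn C v) := by
  by_cases h : v ∈ Γ.nodesOf C
  · rw [hC.2.2.2 v h]; exact even_two
  · rw [deg_zero h]; exact Even.zero

/-- Parity: an edge of a circle has its ends connected in the rest of the circle. -/
theorem circle_Cn [Fintype N] {C : Finset E} (hC : Γ.IsCircle C) {e : E} (he : e ∈ C) :
    Cn Γ ↑(C.erase e) e := by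
  intro a ha b hb
  by_contra hab
  have hne : a ≠ b := fun h => hab (h ▸ Relation.ReflTransGen.refl)
  have hends := ends_pair (hC.2.1 e he) ha hb hne
  let W : Finset N := Finset.univ.filter (fun v => Γ.nodeConn ↑(C.erase e) a v)
  have haW : a ∈ W := by simp [W]; exact Relation.ReflTransGen.refl
  have hbW : b ∉ W := by simp only [W, Finset.mem_filter]; exact fun h => hab h.2
  have h1 : ∑ v ∈ W, Γ.degreeIn C v = ∑ f ∈ C, (W.filter (fun v => v ∈ Γ.ends f)).card := by
    simp only [MGraph.degreeIn, Finset.card_filter]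
    exact Finset.sum_comm
  have h2 : Even (∑ v ∈ W, Γ.degreeIn C v) := Finset.even_sum _ (fun v _ => circle_deg hC v)
  rw [h1, ← Finset.add_sum_erase C _ he] at h2
  have h3 : (W.filter (fun v => v ∈ Γ.ends e)).card = 1 := by
    rw [Finset.card_eq_one]
    refine ⟨a, ?_⟩
    ext x
    rw [hends]
    simp only [Finset.mem_filter, Finset.mem_insert, Finset.mem_singleton]
    constructor
    · rintro ⟨h, rfl | rfl⟩
      · rfl
      · exact absurd h hbW
    · rintro rfl; exact ⟨haW, Or.inl rfl⟩
  have h4 : Even (∑ f ∈ C.erase e, (W.filter (fun v => v ∈ Γ.ends f)).card) := by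
    refine Finset.even_sum _ (fun f hf => ?_)
    have hl := hC.2.1 f (Finset.mem_of_mem_erase hf)
    by_cases hx : ∃ x ∈ W, x ∈ Γ.ends f
    · obtain ⟨x, hxW, hxf⟩ := hx
      have : W.filter (fun v => v ∈ Γ.ends f) = Γ.ends f := by
        ext y
        simp only [Finset.mem_filter, and_iff_right_iff_imp]
        intro hy
        simp only [W, Finset.mem_filter, Finset.mem_univ, true_and] at hxW ⊢
        exact hxW.tail ⟨f, hf, hxf, hy⟩
      rw [this, hl]; exact even_two
    · push Not at hx
      rw [Finset.filter_eq_empty_iff.2 hx]; simp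
  rw [h3] at h2
  have := Nat.even_add.1 h2
  simp only [h4, iff_true] at this
  exact absurd this (by decide)

theorem circle_two {C : Finset E} (hC : Γ.IsCircle C) {e : E} (he : e ∈ C) :
    ∃ f ∈ C, f ≠ e := by
  have hl := hC.2.1 e he
  obtain ⟨a, b, hab, hends⟩ := Finset.card_eq_two.1 hl
  have ha : a ∈ Γ.ends e := by simp [hends]
  have h2 := hC.2.2.2 a (mem_nodes.2 ⟨e, he, ha⟩)
  have h3 : 1 < (C.filter (fun e => a ∈ Γ.ends e)).card := by
    have : (C.filter (fun e => a ∈ Γ.ends e)).card = 2 := h2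
    omega
  obtain ⟨f, hf, hne⟩ := Finset.exists_mem_ne h3 e
  exact ⟨f, (Finset.mem_filter.1 hf).1, hne⟩

/-- A circle in a theta graph meeting a path of the theta contains the path. -/
theorem theta_prop {R Q C : Finset E} {u v : N} (hQ : Γ.IsPath Q u v) 
    (hn : (↑(Γ.nodesOf Q) ∩ ↑(Γ.nodesOf R) : Set N) ⊆ {u, v})
    (hC : Γ.IsCircle C) (hCs : C ⊆ R ∪ Q) {g : E} (hg : g ∈ C) (hgQ : g ∈ Q) : Q ⊆ C := by
  obtain ⟨q1, q2, q3, q4, q5, q6, q7, q8, q9⟩ := hQ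
  intro f hf
  have := q4 g hgQ f hf
  induction this with
  | refl => exact hg
  | @tail x y _ hxy ih =>
    obtain ⟨hx, hy, w, hwx, hwy⟩ := hxy
    have hx : x ∈ Q := hx
    have hy : y ∈ Q := hy
    have ih := ih hx
    by_cases hne : x = y
    · rw [← hne]; exact ih
    have hwQ : w ∈ Γ.nodesOf Q := mem_nodes.2 ⟨x, hx, hwx⟩
    have hx' : x ∈ Q.filter (fun e => w ∈ Γ.ends e) := by simp [hx, hwx]
    have hy' : y ∈ Q.filter (fun e => w ∈ Γ.ends e) := by simp [hy, hwy]
    have hd : Γ.degreeIn Q w ≠ 1 := by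
      intro h1
      have h1 : (Q.filter (fun e => w ∈ Γ.ends e)).card ≤ 1 := h1.le
      exact hne (Finset.card_le_one.1 h1 x hx' y hy')
    have hwu : w ≠ u := fun h => hd (h ▸ q7)
    have hwv : w ≠ v := fun h => hd (h ▸ q8)
    have hwR : w ∉ Γ.nodesOf R := by
      intro h
      rcases hn ⟨hwQ, h⟩ with h | h
      exacts [hwu h, hwv h]
    have hsub : C.filter (fun e => w ∈ Γ.ends e) ⊆ Q.filter (fun e => w ∈ Γ.ends e) := by
      intro z hz
      simp only [Finset.mem_filter] at hz ⊢
      refine ⟨?_, hz.2⟩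
      rcases Finset.mem_union.1 (hCs hz.1) with h | h
      · exact absurd (mem_nodes.2 ⟨z, h, hz.2⟩) hwR
      · exact h
    have h1 : (C.filter (fun e => w ∈ Γ.ends e)).card = 2 :=
      hC.2.2.2 w (mem_nodes.2 ⟨x, ih, hwx⟩)
    have h2 : (Q.filter (fun e => w ∈ Γ.ends e)).card = 2 := q9 w hwQ hwu hwv
    have h3 := Finset.eq_of_subset_of_card_le hsub (by omega)
    rw [← h3] at hy'
    exact (Finset.mem_filter.1 hy').1

end graph

section main
variable {P N E : Type*} [Fintype N]

def II (hP : E → Set P) (S : Set E) : Set P := ⋂ e ∈ S, hP e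

theorem II_mono {hP : E → Set P} {S T : Set E} (h : S ⊆ T) : II hP T ⊆ II hP S :=
  Set.biInter_mono h (fun _ _ => subset_rfl)

theorem II_insert {hP : E → Set P} {S : Set E} {e : E} : 
    II hP (insert e S) = II hP S ∩ hP e := by
  rw [II, Set.biInter_insert, Set.inter_comm]; rfl

theorem II_sub {hP : E → Set P} {S : Set E} {e : E} (he : e ∈ S) : II hP S ⊆ hP e :=
  Set.biInter_subset_of_mem he

structure Ax (G : ProjGeom P) (hinf : Set P) (hP : E → Set P) (Γ : MGraph N E)
    (B : Set (Finset E)) : Prop where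
  inf : G.IsHyperplane hinf
  link : ∀ e, Γ.IsLink e
  hyp : ∀ e, G.IsHyperplane (hP e)
  cn : ∀ (F : Finset E) (e : E), II hP ↑F ∩ hinf ⊆ hP e ↔ Cn Γ ↑F e
  bal : ∀ C : Finset E, C ∈ B ↔ Γ.IsCircle C ∧ ¬ II hP ↑C ⊆ hinf

namespace Ax
variable {G : ProjGeom P} {hinf : Set P} {hP : E → Set P} {Γ : MGraph N E}
    {B : Set (Finset E)} (A : Ax G hinf hP Γ B)
include A

theorem flat (S : Set E) : G.IsFlat (II hP S) := by
  intro p hp q hq x hx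
  simp only [II, Set.mem_iInter] at hp hq ⊢
  exact fun e he => (A.hyp e).1 p (hp e he) q (hq e he) hx

theorem ext {F : Finset E} {e : E} (h1 : ¬ II hP ↑F ⊆ hinf) (h2 : ¬ Cn Γ ↑F e) :
    ¬ II hP (insert e ↑F) ⊆ hinf := by
  rw [II_insert]
  intro h
  exact h2 ((A.cn F e).1 (exch (A.flat _) (A.hyp e) A.inf h h1))

theorem closure {C : Finset E} (hC : C ∈ B) {e : E} (he : e ∈ C) :
    II hP ↑(C.erase e) ⊆ hP e := by
  obtain ⟨h1, h2⟩ := (A.bal C).1 hC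
  by_contra hcon
  have h3 := (A.cn _ _).2 (circle_Cn h1 he)
  have h4 := exch (A.flat _) A.inf (A.hyp e) h3 hcon
  rw [← II_insert, ← Finset.coe_insert, Finset.insert_erase he] at h4
  exact h2 h4

theorem four (S : Set E) : ¬ II hP S ⊆ hinf ↔ Γ.IsBalancedSet B S := by
  constructor
  · intro h
    exact ⟨fun e _ => A.link e, fun C hCS hC => (A.bal C).2 ⟨hC, fun h' => h ((II_mono hCS).trans h')⟩⟩
  · intro hS
    -- maximal-rank finite F
    have hex : ∃ m, ∃ F : Finset E, ↑F ⊆ S ∧ ¬ II hP ↑F ⊆ hinf ∧ Γ.numComponents (↑F : Set E) = m :=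
      ⟨_, ∅, by simp, by
        simp only [II, Finset.coe_empty, Set.mem_empty_iff_false, Set.iInter_of_empty, Set.iInter_univ]
        exact fun h => A.inf.2.1 (Set.univ_subset_iff.1 h), rfl⟩
    obtain ⟨F, hFS, hF, hFm⟩ := Nat.find_spec hex
    have hcn : ∀ e ∈ S, Cn Γ ↑F e := by
      intro e he
      by_contra hcon
      have h1 := A.ext hF hcon
      have h2 := rk_lt hcon
      have h3 := Nat.find_min' hex ⟨insert e F, by
        rw [Finset.coe_insert]; exact Set.insert_subset he hFS, by
        rw [Finset.coe_insert]; exact h1, rfl⟩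
      rw [← hFm, Finset.coe_insert] at h3
      simp only [MGraph.graphicRk] at h2
      omega
    have hsub : II hP ↑F ⊆ II hP S := by
      refine Set.subset_iInter₂ ?_
      intro e he
      by_cases heF : e ∈ F
      · exact II_sub (by simpa using heF)
      obtain ⟨C, hC1, hC2, hC3⟩ := exists_circle (fun e _ => A.link e) (A.link e)
        (by simpa using heF) (hcn e he)
      have hCB := hS.2 C (hC1.trans (Set.insert_subset he hFS)) hC3
      refine subset_trans (II_mono ?_) (A.closure hCB hC2)
      intro f hf
      rw [Finset.mem_coe, Finset.mem_erase] at hf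
      exact (hC1 hf.2).resolve_left hf.1
    exact fun h => hF (hsub.trans h)

theorem one : Γ.IsLinearClass B := by
  refine ⟨fun C hC => ((A.bal C).1 hC).1, ?_⟩
  intro u v P₁ P₂ P₃ p1 p2 p3 d12 d13 d23 n12 n13 n23 b12 b13
  refine (A.bal _).2 ⟨circle_of_paths p2 p3 d23 n23, ?_⟩
  obtain ⟨e, he⟩ := p3.1
  have hK : ∀ K : Finset E, K ⊆ P₃.erase e → ¬ II hP ↑(P₁ ∪ P₂ ∪ K) ⊆ hinf := by
    intro K
    induction K using Finset.induction_on with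
    | empty => intro _; rw [Finset.union_empty]; exact ((A.bal _).1 b12).2
    | insert g K hgK ih =>
      intro hK
      have hKP : K ⊆ P₃.erase e := (Finset.subset_insert _ _).trans hK
      have hg : g ∈ P₃.erase e := hK (Finset.mem_insert_self _ _)
      have hgP := Finset.mem_of_mem_erase hg
      rw [Finset.union_insert, Finset.coe_insert]
      refine A.ext (ih hKP) ?_
      intro hcn
      obtain ⟨C, hC1, hC2, hC3⟩ := exists_circle (fun e _ => A.link e) (A.link g) (by
        rw [Finset.mem_coe, Finset.mem_union, Finset.mem_union]
        rintro ((h | h) | h)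
        · exact Finset.disjoint_left.1 d13 h hgP
        · exact Finset.disjoint_left.1 d23 h hgP
        · exact hgK h) hcn
      rw [← Finset.coe_insert, ← Finset.union_insert, Finset.coe_subset] at hC1
      have hsub := theta_prop (R := P₁ ∪ P₂) p3 (by
        rintro x ⟨h1, h2⟩
        rcases nodes_union.1 h2 with h | h
        · rw [← n13]; exact ⟨h, h1⟩
        · rw [← n23]; exact ⟨h, h1⟩) hC3
          (hC1.trans (Finset.union_subset_union subset_rfl (hK.trans (Finset.erase_subset _ _)))) hC2 hgP
      rcases Finset.mem_union.1 (hC1 (hsub he)) with h | h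
      · rcases Finset.mem_union.1 h with h | h
        · exact Finset.disjoint_left.1 d13 h he
        · exact Finset.disjoint_left.1 d23 h he
      · exact (Finset.mem_erase.1 (hK h)).1 rfl
  have h1 := hK _ subset_rfl
  have h2 := A.closure b13 (Finset.mem_union_right _ he)
  intro h
  apply h1
  refine subset_trans ?_ h
  refine Set.subset_iInter₂ ?_
  intro f hf
  by_cases hfe : f = e
  · subst hfe
    refine subset_trans (II_mono ?_) h2
    intro x hx
    simp only [Finset.coe_erase, Finset.coe_union, Set.mem_sdiff, Set.mem_union, Finset.mem_coe, Set.mem_singleton_iff] at hx ⊢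
    tauto
  · apply II_sub
    simp only [Finset.coe_erase, Finset.coe_union, Set.mem_sdiff, Set.mem_union, Finset.mem_coe, Set.mem_singleton_iff] at hf ⊢
    tauto

/-- Extended hyperplane family. -/
theorem lift_eq (S : Finset (E ⊕ Unit)) (x : E ⊕ Unit) :
    (II (Sum.elim hP (fun _ : Unit => hinf)) ↑S ⊆ Sum.elim hP (fun _ : Unit => hinf) x →
      Γ.liftRk B ↑(insert x S) = Γ.liftRk B ↑S) ∧
    (¬ II (Sum.elim hP (fun _ : Unit => hinf)) ↑S ⊆ Sum.elim hP (fun _ : Unit => hinf) x →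
      Γ.liftRk B ↑S < Γ.liftRk B ↑(insert x S)) := by
  obtain ⟨F, hF⟩ : ∃ F : Finset E, (↑F : Set E) = {e | Sum.inl e ∈ (↑S : Set (E ⊕ Unit))} := by
    refine ⟨S.preimage Sum.inl Sum.inl_injective.injOn, by ext e; simp⟩
  have hI1 : Sum.inr () ∉ S → II (Sum.elim hP (fun _ : Unit => hinf)) ↑S = II hP ↑F := by
    intro h
    rw [hF]
    ext p
    simp only [II, Set.mem_iInter, Finset.mem_coe, Sum.forall, Sum.elim_inl, Set.mem_ofPred_eq, Sum.elim_inr]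
    exact ⟨fun h => h.1, fun h' => ⟨h', fun b hb => absurd hb h⟩⟩
  have hI2 : Sum.inr () ∈ S → II (Sum.elim hP (fun _ : Unit => hinf)) ↑S = II hP ↑F ∩ hinf := by
    intro h
    rw [hF]
    ext p
    simp only [II, Set.mem_inter_iff, Set.mem_iInter, Finset.mem_coe, Sum.forall, Sum.elim_inl, Set.mem_ofPred_eq, Sum.elim_inr]
    exact ⟨fun h' => ⟨h'.1, h'.2 () h⟩, fun h' => ⟨h'.1, fun _ _ => h'.2⟩⟩
  have hrk : Γ.liftRk B ↑S = if ¬ II hP ↑F ⊆ hinf ∧ Sum.inr () ∉ S then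
      Γ.graphicRk ↑F else Γ.graphicRk ↑F + 1 := by
    rw [MGraph.liftRk, ← hF]
    simp only [A.four, MGraph.graphicRk, Finset.mem_coe]
  rcases x with e | ⟨⟩
  · have hrk' : Γ.liftRk B ↑(insert (Sum.inl e) S) =
        if ¬ (II hP ↑F ∩ hP e) ⊆ hinf ∧ Sum.inr () ∉ S then
        Γ.graphicRk (insert e ↑F) else Γ.graphicRk (insert e ↑F) + 1 := by
      have : {e' | Sum.inl e' ∈ (↑(insert (Sum.inl e) S) : Set (E ⊕ Unit))} = insert e ↑F := by
        rw [hF]; ext e'; simp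
      rw [MGraph.liftRk, this, ← II_insert]
      simp [MGraph.graphicRk, A.four]
    rw [hrk, hrk', Sum.elim_inl]
    by_cases hS : Sum.inr () ∈ S
    · rw [hI2 hS, A.cn]
      simp only [hS, not_true, and_false, if_false]
      exact ⟨fun h => by rw [rk_eq h], fun h => by have := rk_lt h; omega⟩
    · rw [hI1 hS]
      simp only [hS, not_false_iff, and_true]
      by_cases hb : II hP ↑F ⊆ hinf
      · have h1 : II hP ↑F ∩ hP e ⊆ hinf := Set.inter_subset_left.trans hb
        have h2 : II hP ↑F = II hP ↑F ∩ hinf := (Set.inter_eq_left.2 hb).symm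
        simp only [hb, h1, not_true, if_false]
        rw [h2, A.cn]
        exact ⟨fun h => by rw [rk_eq h], fun h => by have := rk_lt h; omega⟩
      · simp only [hb, not_false_iff, if_true]
        constructor
        · intro h
          have h3 : Cn Γ ↑F e := (A.cn F e).1 (Set.inter_subset_left.trans h)
          rw [Set.inter_eq_left.2 h, if_pos hb, rk_eq h3]
        · intro h
          by_cases h3 : Cn Γ ↑F e
          · have h4 := exch (A.flat _) A.inf (A.hyp e) ((A.cn F e).2 h3) h
            simp only [h4, not_true, if_false]
            rw [rk_eq h3]; omega
          · have := rk_lt h3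
            split_ifs <;> omega
  · have hrk' : Γ.liftRk B ↑(insert (Sum.inr ()) S) = Γ.graphicRk ↑F + 1 := by
      have : {e' | Sum.inl e' ∈ (↑(insert (Sum.inr ()) S) : Set (E ⊕ Unit))} = ↑F := by
        rw [hF]; ext e'; simp
      rw [MGraph.liftRk, this]
      simp [MGraph.graphicRk]
    rw [hrk, hrk', Sum.elim_inr]
    by_cases hS : Sum.inr () ∈ S
    · rw [hI2 hS]
      simp [hS]
    · rw [hI1 hS]
      by_cases hb : II hP ↑F ⊆ hinf <;> simp [hS, hb]

theorem lift_bdd (S : Set (E ⊕ Unit)) : Γ.liftRk B S ≤ Fintype.card N + 1 := by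
  rw [MGraph.liftRk]; split_ifs <;> omega

theorem exists_fin (T : Set (E ⊕ Unit)) : ∃ S₀ : Finset (E ⊕ Unit), ↑S₀ ⊆ T ∧
    II (Sum.elim hP (fun _ : Unit => hinf)) ↑S₀ = II (Sum.elim hP (fun _ : Unit => hinf)) T := by
  have hex : ∃ m, ∃ S : Finset (E ⊕ Unit), ↑S ⊆ T ∧ Fintype.card N + 1 - Γ.liftRk B ↑S = m :=
    ⟨_, ∅, by simp, rfl⟩
  obtain ⟨S, hST, hSm⟩ := Nat.find_spec hex
  refine ⟨S, hST, subset_antisymm (Set.subset_iInter₂ ?_) (II_mono hST)⟩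
  intro x hx
  by_contra hcon
  have h1 := (A.lift_eq S x).2 hcon
  have h2 := A.lift_bdd (↑(insert x S) : Set (E ⊕ Unit))
  have h3 := Nat.find_min' hex ⟨insert x S, by
    rw [Finset.coe_insert]; exact Set.insert_subset hx hST, rfl⟩
  rw [← hSm] at h3
  omega

theorem three (T : Set (E ⊕ Unit)) : Γ.LiftClosed B T ↔
      T = {x : E ⊕ Unit | (⋂ y ∈ T, Sum.elim hP (fun _ : Unit => hinf) y)
              ⊆ Sum.elim hP (fun _ : Unit => hinf) x} := by
  change _ ↔ T = {x : E ⊕ Unit | II (Sum.elim hP (fun _ : Unit => hinf)) T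
              ⊆ Sum.elim hP (fun _ : Unit => hinf) x}
  constructor
  · intro h
    refine subset_antisymm (fun x hx => II_sub hx) ?_
    intro x hx
    obtain ⟨S, hS, hI⟩ := A.exists_fin T
    exact h x ⟨S, hS, (A.lift_eq S x).1 (hI ▸ hx)⟩
  · rintro h x ⟨S, hS, hr⟩
    rw [h]
    refine subset_trans (II_mono hS) ?_
    by_contra hcon
    have := (A.lift_eq S x).2 hcon
    omega

theorem cn_set {S : Set E} {e : E} (h : II hP S ⊆ hP e) : Cn Γ S e := by
  obtain ⟨S₀, h1, h2⟩ := A.exists_fin (Sum.inl '' S)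
  have h3 : II (Sum.elim hP (fun _ : Unit => hinf)) (Sum.inl '' S) = II hP S := by
    simp [II]
  obtain ⟨F, hFS, rfl⟩ := Finset.subset_set_image_iff.1 h1
  have h4 : II (Sum.elim hP (fun _ : Unit => hinf)) (↑(F.image (Sum.inl : E → E ⊕ Unit)) : Set (E ⊕ Unit)) = II hP ↑F := by
    simp [II]
  rw [h3, h4] at h2
  exact Cn.mono hFS ((A.cn F e).1 (Set.inter_subset_left.trans (h2 ▸ h)))

theorem aff_ne (S : Set E) : (affInter hinf hP S).Nonempty ↔ ¬ II hP S ⊆ hinf := by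
  rw [Set.not_subset]
  rcases S.eq_empty_or_nonempty with rfl | ⟨e, he⟩
  · have : ∃ a, a ∉ hinf := (Set.ne_univ_iff_exists_notMem _).1 A.inf.2.1
    obtain ⟨a, ha⟩ := this
    simp only [affInter, II, Set.mem_empty_iff_false, Set.iInter_of_empty, Set.iInter_univ]
    exact ⟨fun _ => ⟨a, trivial, ha⟩, fun _ => ⟨a, trivial⟩⟩
  · simp only [affInter, II, Set.Nonempty, Set.mem_iInter, Set.mem_sdiff]
    exact ⟨fun ⟨p, hp⟩ => ⟨p, fun f hf => (hp f hf).1, (hp e he).2⟩,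
      fun ⟨p, h1, h2⟩ => ⟨p, fun f hf => ⟨h1 f hf, h2⟩⟩⟩

theorem aff_sub {S : Set E} (hS : ¬ II hP S ⊆ hinf) (e : E) :
    affInter hinf hP S ⊆ hP e \ hinf ↔ II hP S ⊆ hP e := by
  constructor
  · intro h
    refine subset_of_diff (A.flat S) A.inf (A.hyp e) hS ?_
    rintro p ⟨h1, h2⟩
    refine (h ?_).1
    simp only [affInter, II, Set.mem_iInter, Set.mem_sdiff] at h1 ⊢
    exact fun f hf => ⟨h1 f hf, h2⟩
  · intro h p hp
    rcases S.eq_empty_or_nonempty with rfl | ⟨f, hf⟩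
    · exfalso
      apply (A.hyp e).2.1
      simpa [II, Set.univ_subset_iff] using h
    · simp only [affInter, Set.mem_iInter, Set.mem_sdiff] at hp
      exact ⟨h (by simp only [II, Set.mem_iInter]; exact fun g hg => (hp g hg).1), (hp f hf).2⟩

theorem two (S : Set E) : (Γ.IsBalancedSet B S ∧ MGraph.bcl B S = S) ↔
      ((affInter hinf hP S).Nonempty ∧
        S = {e : E | affInter hinf hP S ⊆ hP e \ hinf}) := by
  rw [A.aff_ne, A.four]
  refine and_congr_right fun hb => ?_
  have hb' := (A.four S).2 hb
  simp only [A.aff_sub hb']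
  have : MGraph.bcl B S = {e | II hP S ⊆ hP e} := by
    ext e
    constructor
    · rintro (he | ⟨C, hC, heC, hCS⟩)
      · exact II_sub he
      · refine subset_trans (II_mono ?_) (A.closure hC heC)
        intro f hf
        rw [Finset.mem_coe, Finset.mem_erase] at hf
        exact (hCS hf.2).resolve_right hf.1
    · intro he
      by_cases heS : e ∈ S
      · exact Or.inl heS
      obtain ⟨C, hC1, hC2, hC3⟩ := exists_circle (fun e _ => A.link e) (A.link e) heS (A.cn_set he)
      refine Or.inr ⟨C, ?_, hC2, by rw [Set.union_singleton]; exact hC1⟩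
      have : Γ.IsBalancedSet B (insert e S) := by
        rw [← A.four, II_insert, Set.inter_eq_left.2 he]; exact hb'
      exact this.2 C hC1 hC3
  rw [this, eq_comm]

end Ax

theorem mkAx {E' : Type*} {G : ProjGeom P} {hinf : Set P} {hP : E → Set P} {Δ : MGraph N E'}
    {π : E → E'} {ideal : E' → Set P} (haff : IsAffinographic G hinf hP Δ π ideal) :
    Ax G hinf hP (affinoGraph Δ π) (affinoBal G hinf hP Δ π) := by
  obtain ⟨hi, hl, hsurj, hinj, hidinj, hh, hr⟩ := haff
  have hrk : ∀ F : Finset E, (affinoGraph Δ π).graphicRk ↑F =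
      G.codim (⋂₀ ↑(insert hinf (F.image hP))) - 1 := by
    intro F
    have h1 : (affinoGraph Δ π).graphicRk ↑F = Δ.graphicRk ↑(F.image π) := by
      have : ∀ u v, (affinoGraph Δ π).adjIn (↑F) u v = Δ.adjIn ↑(F.image π) u v := by
        intro u v
        simp [MGraph.adjIn, affinoGraph]
      have : (affinoGraph Δ π).adjIn (↑F) = Δ.adjIn ↑(F.image π) := by
        funext u v; exact this u v
      simp only [MGraph.graphicRk, MGraph.numComponents, MGraph.components, MGraph.nodeConn, this]
    rw [h1, hr]
    congr 2
    ext p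
    simp only [Set.mem_inter_iff, Set.mem_iInter, Finset.mem_image, forall_exists_index, and_imp,
      forall_apply_eq_imp_iff₂, Finset.coe_insert, Finset.coe_image, Set.sInter_insert,
      Set.sInter_image, Finset.mem_coe]
    refine and_congr_right fun hp => forall₂_congr fun e he => ?_
    rw [← (hh e).2.2]
    simp [hp]
  have hcap : ∀ F : Finset E, ⋂₀ (↑(insert hinf (F.image hP)) : Set (Set P)) = II hP ↑F ∩ hinf := by
    intro F
    rw [Finset.coe_insert, Set.sInter_insert, Finset.coe_image, Set.sInter_image, Set.inter_comm]; rfl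
  have hhyp : ∀ F : Finset E, ∀ h ∈ insert hinf (F.image hP), G.IsHyperplane h := by
    intro F h hm
    rcases Finset.mem_insert.1 hm with rfl | hm
    · exact hi
    · obtain ⟨e, _, rfl⟩ := Finset.mem_image.1 hm
      exact (hh e).1
  have hpos : ∀ F : Finset E, 1 ≤ G.codim (⋂₀ ↑(insert hinf (F.image hP))) := by
    intro F
    refine codim_pos (hhyp F) ?_
    rw [hcap]
    intro h
    exact hi.2.1 (Set.univ_subset_iff.1 (h ▸ Set.inter_subset_right))
  have hflat : ∀ S : Set E, G.IsFlat (II hP S) := by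
    intro S p hp q hq x hx
    simp only [II, Set.mem_iInter] at hp hq ⊢
    exact fun e he => (hh e).1.1 p (hp e he) q (hq e he) hx
  refine ⟨hi, fun e => hl (π e), fun e => (hh e).1, ?_, ?_⟩
  · intro F e
    have hcap' : ⋂₀ (↑(insert hinf ((insert e F).image hP)) : Set (Set P)) =
        ⋂₀ (↑(insert hinf (F.image hP)) : Set (Set P)) ∩ hP e := by
      rw [hcap, hcap, Finset.coe_insert, II_insert, Set.inter_right_comm]
    constructor
    · intro h
      by_contra hcon
      have h1 := rk_lt hcon
      rw [← Finset.coe_insert, hrk, hrk, hcap', Set.inter_eq_left.2 (hcap F ▸ h)] at h1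
      omega
    · intro h
      have h1 := rk_eq h
      rw [← Finset.coe_insert, hrk, hrk, hcap'] at h1
      have h2 := hpos F
      have h3 := hpos (insert e F)
      rw [hcap'] at h3
      rw [← hcap]
      exact codim_inter (hhyp F) (hh e).1 (by omega)
  · intro C
    constructor
    · rintro ⟨h1, _, p, hp⟩
      refine ⟨h1, ?_⟩
      obtain ⟨e, he⟩ := h1.1
      simp only [affInter, Set.mem_iInter, Set.mem_sdiff, Finset.mem_coe] at hp
      intro h
      exact (hp e he).2 (h (by simp only [II, Set.mem_iInter]; exact fun f hf => (hp f hf).1))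
    · rintro ⟨h1, h2⟩
      obtain ⟨p, hp, hpi⟩ := Set.not_subset.1 h2
      simp only [II, Set.mem_iInter, Finset.mem_coe] at hp
      refine ⟨h1, ?_, p, ?_⟩
      · rintro ⟨f, hf⟩
        obtain ⟨e, he⟩ := h1.1
        obtain ⟨e', he', hne⟩ := circle_two h1 he
        have h3 : hP e ∩ hinf ⊆ hP e' := by
          rw [(hh e).2.2, hf e he, ← hf e' he', ← (hh e').2.2]
          exact Set.inter_subset_left
        have h4 : hP e ⊆ hP e' := by
          by_contra hcon
          exact hpi (exch (hh e).1.1 hi (hh e').1 h3 hcon ⟨hp e he, hp e' he'⟩)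
        rcases (hh e).1.2.2 _ (hh e').1.1 h4 with h5 | h5
        · exact hne (hinj h5)
        · exact (hh e').1.2.1 h5
      · simp only [affInter, Set.mem_iInter, Set.mem_sdiff, Finset.mem_coe]
        exact fun e he => ⟨hp e he, hpi⟩

end main

end Aff

/-! ## Statement 15 -/

/-- Let `A` be a synthetic affinographic arrangement of
hyperplanes in an affine geometry (projective completion with ideal hyperplane
`hinf`), with associated graph `Δ` and constructed graph-with-bias `Ω(A)`.
Then: (1) `Ω(A)` is a biased graph; (2) the nonempty intersections `t_A(S)`
(ordered by reverse inclusion) correspond to the closed balanced edge sets of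
`Ω(A)` via `h_e ↦ e`; (3) the intersection lattice of the projectivized
arrangement `A_P = {h_e^P} ∪ {hinf}` corresponds to the lattice of closed sets of
the extended lift matroid `L₀(Ω(A))` via the same correspondence together with
`hinf ↦ e₀`; and (4) `t_A(S) ≠ ∅` if and only if `S` is balanced in `Ω(A)`. -/
theorem stmt15 {P N E E' : Type*} [Fintype N] (G : ProjGeom P)
    (hinf : Set P) (hP : E → Set P) (Δ : MGraph N E') (π : E → E')
    (ideal : E' → Set P)
    (haff : IsAffinographic G hinf hP Δ π ideal) :
    (affinoGraph Δ π).IsLinearClass (affinoBal G hinf hP Δ π) ∧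
    (∀ S : Set E,
      ((affinoGraph Δ π).IsBalancedSet (affinoBal G hinf hP Δ π) S ∧
        MGraph.bcl (affinoBal G hinf hP Δ π) S = S) ↔
      ((affInter hinf hP S).Nonempty ∧
        S = {e : E | affInter hinf hP S ⊆ hP e \ hinf})) ∧
    (∀ T : Set (E ⊕ Unit),
      (affinoGraph Δ π).LiftClosed (affinoBal G hinf hP Δ π) T ↔
      T = {x : E ⊕ Unit | (⋂ y ∈ T, Sum.elim hP (fun _ : Unit => hinf) y)
              ⊆ Sum.elim hP (fun _ : Unit => hinf) x}) ∧
    (∀ S : Set E, (affInter hinf hP S).Nonempty ↔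
      (affinoGraph Δ π).IsBalancedSet (affinoBal G hinf hP Δ π) S) := by
  have A := Aff.mkAx haff
  exact ⟨A.one, A.two, A.three, fun S => (A.aff_ne S).trans (A.four S)⟩
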